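/- (Characterization of equality in the duality.) With notation as in the weak duality statement, equality I(ρ, γ) = J[σ](Ψ, P) holds if and only if (a) γ = (id × ∇P)_# (e(s)χ_{D_ρ} ℒ²), i.e., γ is concentrated on the graph of ∇P, and (b) for almost every z ∈ [0,H], ρ(z) ∈ Argmin Π_P(·, z). -/

import Mathlib

open MeasureTheory

/-- `e(s) = r0^4/(1-2 s r0²)²`. -/
noncomputable def eFun (r0 s : ℝ) : ℝ := r0 ^ 4 / (1 - 2 * s * r0 ^ 2) ^ 2

/-- `Π_P(ρ,z)`. -/
noncomputable def PiFun (r0 Ω : ℝ) (P : ℝ × ℝ → ℝ) (ρ z : ℝ) : ℝ :=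
  ∫ s in (0 : ℝ)..ρ, (Ω ^ 2 * r0 ^ 2 / (2 * (1 - 2 * s * r0 ^ 2)) - P (s, z)) * eFun r0 s

/-- `Argmin Π_P(·,z)` over `[0, 1/(2r0²))`. -/
noncomputable def ArgminPi (r0 Ω : ℝ) (P : ℝ × ℝ → ℝ) (z : ℝ) : Set ℝ :=
  {ρ ∈ Set.Ico (0 : ℝ) (1 / (2 * r0 ^ 2)) |
    ∀ ρ' ∈ Set.Ico (0 : ℝ) (1 / (2 * r0 ^ 2)), PiFun r0 Ω P ρ z ≤ PiFun r0 Ω P ρ' z}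

/-- The domain `𝒟 = [0, 1/(2r0²)) × [0,H]`. -/
def Dom (r0 H : ℝ) : Set (ℝ × ℝ) := Set.Ico (0 : ℝ) (1 / (2 * r0 ^ 2)) ×ˢ Set.Icc (0 : ℝ) H

/-- `(P,Ψ) ∈ 𝒰₀`: conjugate pair with Fenchel–Young inequality. -/
def memU0 (r0 H : ℝ) (Δ : Set (ℝ × ℝ)) (P Ψ : ℝ × ℝ → ℝ) : Prop :=
  (∀ p ∈ Dom r0 H, P p = sSup ((fun q : ℝ × ℝ => p.1 * q.1 + p.2 * q.2 - Ψ q) '' Δ)) ∧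
  (∀ q : ℝ × ℝ, 0 ≤ q.1 → 0 ≤ q.2 →
    Ψ q = sSup ((fun p : ℝ × ℝ => p.1 * q.1 + p.2 * q.2 - P p) '' Dom r0 H)) ∧
  (∀ p ∈ Dom r0 H, ∀ q : ℝ × ℝ, 0 ≤ q.1 → 0 ≤ q.2 →
    p.1 * q.1 + p.2 * q.2 ≤ P p + Ψ q)

/-- `D_ρ = { (s,z) : 0 ≤ s ≤ ρ(z), z ∈ [0,H] }`. -/
def Dset (H : ℝ) (ρ : ℝ → ℝ) : Set (ℝ × ℝ) :=
  {p : ℝ × ℝ | p.2 ∈ Set.Icc (0 : ℝ) H ∧ p.1 ∈ Set.Icc (0 : ℝ) (ρ p.2)}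

/-- The measure `e(s) χ_{D_ρ} ℒ²`. -/
noncomputable def muD (r0 H : ℝ) (ρ : ℝ → ℝ) : Measure (ℝ × ℝ) :=
  MeasureTheory.volume.withDensity
    (fun p => ENNReal.ofReal ((Dset H ρ).indicator (fun p : ℝ × ℝ => eFun r0 p.1) p))

/-- The transport cost `−⟨p,q⟩ + Υ/(2r0²) − Ω√Υ + r0²Ω²/(2(1−2r0² s))`. -/
noncomputable def cost (r0 Ω : ℝ) (pq : (ℝ × ℝ) × (ℝ × ℝ)) : ℝ :=
  -(pq.1.1 * pq.2.1 + pq.1.2 * pq.2.2) + pq.2.1 / (2 * r0 ^ 2)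
    - Ω * Real.sqrt pq.2.1 + r0 ^ 2 * Ω ^ 2 / (2 * (1 - 2 * r0 ^ 2 * pq.1.1))

/-- `j(P)`. -/
noncomputable def jP (r0 Ω H : ℝ) (P : ℝ × ℝ → ℝ) : ℝ :=
  sInf {x : ℝ | ∃ ρt : ℝ → ℝ, Measurable ρt ∧
    (∀ z, ρt z ∈ Set.Ico (0 : ℝ) (1 / (2 * r0 ^ 2))) ∧
    x = ∫ z in (0 : ℝ)..H, PiFun r0 Ω P (ρt z) z}

/-- `J[σ](Ψ,P)`. -/
noncomputable def Jfun (r0 Ω H : ℝ) (σ : Measure (ℝ × ℝ)) (Ψ P : ℝ × ℝ → ℝ) : ℝ :=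
  (∫ q : ℝ × ℝ, (q.1 / (2 * r0 ^ 2) - Ω * Real.sqrt q.1 - Ψ q) ∂σ) + jP r0 Ω H P

/-- The gradient `∇P` of a function on `ℝ²`. -/
noncomputable def gradP (P : ℝ × ℝ → ℝ) (p : ℝ × ℝ) : ℝ × ℝ :=
  (fderiv ℝ P p (1, 0), fderiv ℝ P p (0, 1))


lemma aux_dom_bd {r0 H : ℝ} {p : ℝ × ℝ} (hp : p ∈ Dom r0 H) :
    0 ≤ p.1 ∧ p.1 < 1 / (2 * r0 ^ 2) ∧ 0 ≤ p.2 ∧ p.2 ≤ H := by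
  obtain ⟨⟨h1, h2⟩, h3, h4⟩ := hp
  exact ⟨h1, h2, h3, h4⟩

lemma aux_delta_bd {R0 : ℝ} {Δ : Set (ℝ × ℝ)} (hΔ : Δ ⊆ Set.Icc (0, 0) (R0, R0))
    {q : ℝ × ℝ} (hq : q ∈ Δ) : 0 ≤ q.1 ∧ q.1 ≤ R0 ∧ 0 ≤ q.2 ∧ q.2 ≤ R0 := by
  obtain ⟨⟨h1, h2⟩, h3, h4⟩ := hΔ hq
  exact ⟨h1, h3, h2, h4⟩

lemma aux_pair_lip {p p' q : ℝ × ℝ} {R : ℝ} (h0 : 0 ≤ q.1) (h1 : q.1 ≤ R) (h2 : 0 ≤ q.2)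
    (h3 : q.2 ≤ R) :
    p.1 * q.1 + p.2 * q.2 ≤ p'.1 * q.1 + p'.2 * q.2 + 2 * R * dist p p' := by
  have a1 : p.1 - p'.1 ≤ dist p p' := by
    refine le_trans (le_abs_self _) ?_
    rw [← Real.dist_eq, Prod.dist_eq]; exact le_max_left _ _
  have a2 : p.2 - p'.2 ≤ dist p p' := by
    refine le_trans (le_abs_self _) ?_
    rw [← Real.dist_eq, Prod.dist_eq]; exact le_max_right _ _
  have hd : 0 ≤ dist p p' := dist_nonneg
  nlinarith [mul_le_mul_of_nonneg_right a1 h0, mul_le_mul_of_nonneg_right a2 h2,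
    mul_le_mul_of_nonneg_left h1 hd, mul_le_mul_of_nonneg_left h3 hd]

lemma aux_P_lip {r0 H R0 : ℝ} (hR0 : 1 < R0)
    {Δ : Set (ℝ × ℝ)} (hΔ : Δ ⊆ Set.Icc (0, 0) (R0, R0)) (hne : Δ.Nonempty)
    {P Ψ : ℝ × ℝ → ℝ} (hU0 : memU0 r0 H Δ P Ψ) :
    LipschitzOnWith (Real.toNNReal (2 * R0)) P (Dom r0 H) := by
  obtain ⟨hP, -, hFY⟩ := hU0
  apply LipschitzOnWith.of_le_add_mul
  intro p hp p' hp'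
  rw [Real.coe_toNNReal _ (by linarith), hP p hp]
  apply csSup_le (hne.image _)
  rintro _ ⟨q, hq, rfl⟩
  obtain ⟨h0, h1, h2, h3⟩ := aux_delta_bd hΔ hq
  have := hFY p' hp' q h0 h2
  have := aux_pair_lip (p := p) (p' := p') h0 h1 h2 h3
  simp only
  linarith

lemma aux_Psi_lip {r0 H : ℝ} (hr0 : 0 < r0) (hH : 0 < H)
    {Δ : Set (ℝ × ℝ)} {P Ψ : ℝ × ℝ → ℝ} (hU0 : memU0 r0 H Δ P Ψ) :
    LipschitzOnWith (Real.toNNReal (2 * max (1 / (2 * r0 ^ 2)) H)) Ψ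
      {q | 0 ≤ q.1 ∧ 0 ≤ q.2} := by
  obtain ⟨-, hP, hFY⟩ := hU0
  have hL : 0 < 1 / (2 * r0 ^ 2) := by positivity
  apply LipschitzOnWith.of_le_add_mul
  intro q hq q' hq'
  rw [Real.coe_toNNReal _ (by positivity), hP q hq.1 hq.2]
  have hne : (Dom r0 H).Nonempty := ⟨(0, 0), ⟨le_refl _, hL⟩, le_refl _, hH.le⟩
  apply csSup_le (hne.image _)
  rintro _ ⟨p, hp, rfl⟩
  obtain ⟨h0, h1, h2, h3⟩ := aux_dom_bd hp
  have := hFY p hp q' hq'.1 hq'.2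
  have := aux_pair_lip (p := q) (p' := q') h0 (h1.le.trans (le_max_left _ H)) h2
    (h3.trans (le_max_right (1 / (2 * r0 ^ 2)) _))
  simp only
  linarith

lemma aux_grad {r0 H : ℝ} {Δ : Set (ℝ × ℝ)} {P Ψ : ℝ × ℝ → ℝ} (hU0 : memU0 r0 H Δ P Ψ)
    {p q : ℝ × ℝ} (hp : p ∈ interior (Dom r0 H)) (hd : DifferentiableAt ℝ P p)
    (h1 : 0 ≤ q.1) (h2 : 0 ≤ q.2) (he : P p + Ψ q = p.1 * q.1 + p.2 * q.2) :
    gradP P p = q := by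
  let l : ℝ × ℝ →L[ℝ] ℝ := q.1 • ContinuousLinearMap.fst ℝ ℝ ℝ + q.2 • ContinuousLinearMap.snd ℝ ℝ ℝ
  have hl : ∀ x : ℝ × ℝ, l x = x.1 * q.1 + x.2 * q.2 := fun x => by simp [l]; ring
  have hmin : IsLocalMin (fun x => P x - l x) p := by
    filter_upwards [mem_interior_iff_mem_nhds.1 hp] with x hx
    have := hU0.2.2 x hx q h1 h2
    rw [hl, hl]; linarith
  have h0 := hmin.hasFDerivAt_eq_zero (hd.hasFDerivAt.sub l.hasFDerivAt)
  have h0' : fderiv ℝ P p = l := sub_eq_zero.1 h0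
  unfold gradP
  rw [h0', hl, hl]
  ext <;> simp

lemma aux_attain {r0 H R0 : ℝ} (hr0 : 0 < r0) (hH : 0 < H) 
    {Δ : Set (ℝ × ℝ)} (hΔcl : IsClosed Δ) (hΔ : Δ ⊆ Set.Icc (0, 0) (R0, R0)) (hne : Δ.Nonempty)
    {P Ψ : ℝ × ℝ → ℝ} (hU0 : memU0 r0 H Δ P Ψ) {p : ℝ × ℝ}
    (hp : p ∈ interior (Dom r0 H)) (hd : DifferentiableAt ℝ P p) :
    P p + Ψ (gradP P p) = p.1 * (gradP P p).1 + p.2 * (gradP P p).2 := by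
  have hc : IsCompact Δ := isCompact_Icc.of_isClosed_subset hΔcl hΔ
  have hcont : ContinuousOn (fun q : ℝ × ℝ => p.1 * q.1 + p.2 * q.2 - Ψ q) Δ := by
    have : ContinuousOn Ψ Δ := (aux_Psi_lip hr0 hH hU0).continuousOn.mono
      (fun q hq => by obtain ⟨a, _, b, _⟩ := aux_delta_bd hΔ hq; exact ⟨a, b⟩)
    exact ContinuousOn.sub (by fun_prop) this
  obtain ⟨q, hq, hmax⟩ := hc.exists_isMaxOn hne hcont
  obtain ⟨a, _, b, _⟩ := aux_delta_bd hΔ hq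
  have he : P p + Ψ q = p.1 * q.1 + p.2 * q.2 := by
    apply le_antisymm _ (hU0.2.2 p (interior_subset hp) q a b)
    have : P p ≤ p.1 * q.1 + p.2 * q.2 - Ψ q := by
      rw [hU0.1 p (interior_subset hp)]
      apply csSup_le (hne.image _)
      rintro _ ⟨q', hq', rfl⟩
      exact hmax hq'
    linarith
  rw [aux_grad hU0 hp hd a b he]
  exact he

lemma aux_Dom_meas (r0 H : ℝ) : MeasurableSet (Dom r0 H) :=
  measurableSet_Ico.prod measurableSet_Icc

lemma aux_Dset_meas (H : ℝ) {ρ : ℝ → ℝ} (hρ : Measurable ρ) : MeasurableSet (Dset H ρ) := by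
  have h1 : MeasurableSet {p : ℝ × ℝ | p.2 ∈ Set.Icc (0 : ℝ) H} := measurable_snd measurableSet_Icc
  have h2 : MeasurableSet {p : ℝ × ℝ | 0 ≤ p.1} := measurableSet_le measurable_const measurable_fst
  have h3 : MeasurableSet {p : ℝ × ℝ | p.1 ≤ ρ p.2} :=
    measurableSet_le measurable_fst (hρ.comp measurable_snd)
  exact h1.inter (h2.inter h3)

lemma aux_eFun_meas (r0 : ℝ) : Measurable (eFun r0) := by
  unfold eFun; fun_prop

lemma aux_ae_int {r0 H R0 : ℝ} (hR0 : 1 < R0)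
    {Δ : Set (ℝ × ℝ)} (hΔ : Δ ⊆ Set.Icc (0, 0) (R0, R0)) (hne : Δ.Nonempty)
    {P Ψ : ℝ × ℝ → ℝ} (hU0 : memU0 r0 H Δ P Ψ) :
    ∀ᵐ p : ℝ × ℝ, p ∈ Dom r0 H → p ∈ interior (Dom r0 H) ∧ DifferentiableAt ℝ P p := by
  have hconv : Convex ℝ (Dom r0 H) := (convex_Ico _ _).prod (convex_Icc _ _)
  have hfr : ∀ᵐ p : ℝ × ℝ, p ∉ frontier (Dom r0 H) :=
    measure_eq_zero_iff_ae_notMem.1 (hconv.addHaar_frontier volume)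
  filter_upwards [hfr, (aux_P_lip hR0 hΔ hne hU0).ae_differentiableWithinAt_of_mem (μ := volume)]
    with p h1 h2 hp
  have hi : p ∈ interior (Dom r0 H) := by
    by_contra h
    exact h1 ⟨subset_closure hp, h⟩
  exact ⟨hi, (h2 hp).differentiableAt (mem_interior_iff_mem_nhds.1 hi)⟩

lemma aux_ac (r0 H : ℝ) (ρ : ℝ → ℝ) : muD r0 H ρ ≪ volume :=
  withDensity_absolutelyContinuous _ _

lemma aux_Dset_sub {r0 H : ℝ} {ρ : ℝ → ℝ}
    (hρ : ∀ z ∈ Set.Icc (0 : ℝ) H, ρ z ∈ Set.Ico (0 : ℝ) (1 / (2 * r0 ^ 2))) :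
    Dset H ρ ⊆ Dom r0 H := by
  rintro p ⟨h1, h2, h3⟩
  exact ⟨⟨h2, h3.trans_lt (hρ _ h1).2⟩, h1⟩

lemma aux_ae_Dset {r0 H : ℝ} {ρ : ℝ → ℝ} (hρ : Measurable ρ) :
    ∀ᵐ p ∂(muD r0 H ρ), p ∈ Dset H ρ := by
  unfold muD
  rw [ae_withDensity_iff]
  · refine Filter.Eventually.of_forall fun p hp => ?_
    by_contra h
    simp [h] at hp
  · exact (((aux_eFun_meas r0).comp measurable_fst).indicator (aux_Dset_meas H hρ)).ennreal_ofReal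

lemma aux_good {r0 H R0 : ℝ} (hR0 : 1 < R0)
    {Δ : Set (ℝ × ℝ)} (hΔ : Δ ⊆ Set.Icc (0, 0) (R0, R0)) (hne : Δ.Nonempty)
    {P Ψ : ℝ × ℝ → ℝ} (hU0 : memU0 r0 H Δ P Ψ) {ρ : ℝ → ℝ} (hρm : Measurable ρ)
    (hρ : ∀ z ∈ Set.Icc (0 : ℝ) H, ρ z ∈ Set.Ico (0 : ℝ) (1 / (2 * r0 ^ 2))) :
    ∀ᵐ p ∂(muD r0 H ρ), p ∈ interior (Dom r0 H) ∧ DifferentiableAt ℝ P p := by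
  filter_upwards [(aux_ac r0 H ρ).ae_le (aux_ae_int hR0 hΔ hne hU0), aux_ae_Dset hρm] with p h1 h2
  exact h1 (aux_Dset_sub hρ h2)

lemma aux_gradP_meas (P : ℝ × ℝ → ℝ) : Measurable (gradP P) :=
  (measurable_fderiv_apply_const ℝ P _).prodMk (measurable_fderiv_apply_const ℝ P _)

/-- Part (a): complementary slackness is the graph property. -/
lemma aux_part_a {r0 H R0 : ℝ} (hr0 : 0 < r0) (hH : 0 < H) (hR0 : 1 < R0)
    {Δ : Set (ℝ × ℝ)} (hΔcl : IsClosed Δ) (hΔ : Δ ⊆ Set.Icc (0, 0) (R0, R0)) (hne : Δ.Nonempty)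
    {σ : Measure (ℝ × ℝ)} (hσΔ : σ Δᶜ = 0)
    {P Ψ : ℝ × ℝ → ℝ} (hU0 : memU0 r0 H Δ P Ψ)
    {ρ : ℝ → ℝ} (hρmeas : Measurable ρ)
    (hρ : ∀ z ∈ Set.Icc (0 : ℝ) H, ρ z ∈ Set.Ico (0 : ℝ) (1 / (2 * r0 ^ 2)))
    {γ : Measure ((ℝ × ℝ) × (ℝ × ℝ))}
    (hγ1 : γ.map Prod.fst = muD r0 H ρ) (hγ2 : γ.map Prod.snd = σ) :
    (∀ᵐ pq ∂γ, P pq.1 + Ψ pq.2 - (pq.1.1 * pq.2.1 + pq.1.2 * pq.2.2) = 0) ↔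
      γ = (muD r0 H ρ).map (fun p : ℝ × ℝ => (p, gradP P p)) := by
  have hgood := aux_good hR0 hΔ hne hU0 hρmeas hρ
  have hmm : Measurable (fun p : ℝ × ℝ => (p, gradP P p)) :=
    measurable_id.prodMk (aux_gradP_meas P)
  have hgood' : ∀ᵐ pq ∂γ, pq.1 ∈ interior (Dom r0 H) ∧ DifferentiableAt ℝ P pq.1 := by
    rw [← hγ1] at hgood
    exact ae_of_ae_map measurable_fst.aemeasurable hgood
  have hq : ∀ᵐ pq ∂γ, pq.2 ∈ Δ := by
    have : ∀ᵐ q ∂σ, q ∈ Δ := hσΔ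
    rw [← hγ2] at this
    exact ae_of_ae_map measurable_snd.aemeasurable this
  constructor
  · intro h
    have : ∀ᵐ pq ∂γ, id pq = ((fun p : ℝ × ℝ => (p, gradP P p)) ∘ Prod.fst) pq := by
      filter_upwards [h, hgood', hq] with pq h1 h2 h3
      obtain ⟨a, _, b, _⟩ := aux_delta_bd hΔ h3
      have := aux_grad hU0 h2.1 h2.2 a b (by linarith)
      simp [this]
    calc γ = γ.map id := Measure.map_id.symm
      _ = γ.map ((fun p : ℝ × ℝ => (p, gradP P p)) ∘ Prod.fst) := Measure.map_congr this
      _ = _ := by rw [← Measure.map_map hmm measurable_fst, hγ1]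
  · intro h
    have hgr : ∀ᵐ pq ∂γ, pq.2 = gradP P pq.1 := by
      rw [h]
      refine (ae_map_iff hmm.aemeasurable
        (measurableSet_eq_fun measurable_snd ((aux_gradP_meas P).comp measurable_fst))).2 ?_
      simp
    filter_upwards [hgood', hgr] with pq h1 h2
    rw [h2, aux_attain hr0 hH hΔcl hΔ hne hU0 h1.1 h1.2, sub_self]

/-- The integrand `w - P`. -/
noncomputable def auxW (r0 Ω : ℝ) (P : ℝ × ℝ → ℝ) (p : ℝ × ℝ) : ℝ :=
  Ω ^ 2 * r0 ^ 2 / (2 * (1 - 2 * p.1 * r0 ^ 2)) - P p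

/-- The integrand extended by zero outside of `D_ρ`. -/
noncomputable def auxG (r0 Ω H : ℝ) (P : ℝ × ℝ → ℝ) (ρ : ℝ → ℝ) : ℝ × ℝ → ℝ :=
  (Dset H ρ).indicator (fun p => auxW r0 Ω P p * eFun r0 p.1)

lemma aux_pos {r0 s : ℝ} (hr0 : 0 < r0) (hs : s < 1 / (2 * r0 ^ 2)) : 0 < 1 - 2 * s * r0 ^ 2 := by
  rw [lt_div_iff₀ (by positivity)] at hs
  linarith

lemma aux_contW {r0 Ω H : ℝ} (hr0 : 0 < r0) {P : ℝ × ℝ → ℝ} (hP : ContinuousOn P (Dom r0 H)) :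
    ContinuousOn (fun p : ℝ × ℝ => auxW r0 Ω P p * eFun r0 p.1) (Dom r0 H) := by
  have h : ∀ p ∈ Dom r0 H, 1 - 2 * p.1 * r0 ^ 2 ≠ 0 := fun p hp => (aux_pos hr0 hp.1.2).ne'
  unfold auxW eFun
  refine ContinuousOn.mul (ContinuousOn.sub ?_ hP) ?_
  · refine ContinuousOn.div (by fun_prop) (by fun_prop) fun p hp => mul_ne_zero two_ne_zero (h p hp)
  · refine ContinuousOn.div (by fun_prop) (by fun_prop) fun p hp => pow_ne_zero _ (h p hp)

lemma aux_contz {r0 Ω H : ℝ} (hr0 : 0 < r0) {P : ℝ × ℝ → ℝ} (hP : ContinuousOn P (Dom r0 H))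
    {z b : ℝ} (hz : z ∈ Set.Icc 0 H) (hb : b < 1 / (2 * r0 ^ 2)) :
    ContinuousOn (fun s : ℝ => (Ω ^ 2 * r0 ^ 2 / (2 * (1 - 2 * s * r0 ^ 2)) - P (s, z)) * eFun r0 s)
      (Set.Icc 0 b) := by
  have := (aux_contW (Ω := Ω) hr0 hP).comp (f := fun s : ℝ => (s, z)) (s := Set.Icc 0 b)
    (by fun_prop) (fun s hs => ⟨⟨hs.1, hs.2.trans_lt hb⟩, hz⟩)
  exact this

lemma aux_inner {r0 Ω H : ℝ} {P : ℝ × ℝ → ℝ} {ρ : ℝ → ℝ}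
    (hρ : ∀ z ∈ Set.Icc (0 : ℝ) H, ρ z ∈ Set.Ico (0 : ℝ) (1 / (2 * r0 ^ 2))) (z : ℝ) :
    ∫ s, auxG r0 Ω H P ρ (s, z) =
      (Set.Icc 0 H).indicator (fun z => PiFun r0 Ω P (ρ z) z) z := by
  by_cases hz : z ∈ Set.Icc 0 H
  · rw [Set.indicator_of_mem hz]
    have : (fun s => auxG r0 Ω H P ρ (s, z)) = (Set.Icc 0 (ρ z)).indicator
        (fun s => auxW r0 Ω P (s, z) * eFun r0 s) := by
      funext s
      unfold auxG
      by_cases hs : s ∈ Set.Icc 0 (ρ z)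
      · rw [Set.indicator_of_mem hs, Set.indicator_of_mem]
        exact ⟨hz, hs⟩
      · rw [Set.indicator_of_notMem hs, Set.indicator_of_notMem]
        exact fun h => hs h.2
    rw [this, integral_indicator measurableSet_Icc, integral_Icc_eq_integral_Ioc,
      ← intervalIntegral.integral_of_le (hρ z hz).1]
    rfl
  · rw [Set.indicator_of_notMem hz]
    have : (fun s => auxG r0 Ω H P ρ (s, z)) = fun _ => 0 := by
      funext s
      exact Set.indicator_of_notMem (fun h => hz h.1) _
    rw [this]; simp

lemma aux_fub {r0 Ω H : ℝ} {P : ℝ × ℝ → ℝ} {ρ : ℝ → ℝ}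
    (hρ : ∀ z ∈ Set.Icc (0 : ℝ) H, ρ z ∈ Set.Ico (0 : ℝ) (1 / (2 * r0 ^ 2)))
    (hG : Integrable (auxG r0 Ω H P ρ) volume) :
    IntegrableOn (fun z => PiFun r0 Ω P (ρ z) z) (Set.Icc 0 H) ∧
    ∫ p, auxG r0 Ω H P ρ p = ∫ z in Set.Icc 0 H, PiFun r0 Ω P (ρ z) z := by
  rw [Measure.volume_eq_prod] at hG
  constructor
  · rw [← integrable_indicator_iff measurableSet_Icc]
    have := hG.integral_prod_right
    simpa only [aux_inner hρ] using this
  · rw [Measure.volume_eq_prod, integral_prod_symm _ hG, ← integral_indicator measurableSet_Icc]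
    simp only [aux_inner hρ]

lemma aux_const {r0 Ω H : ℝ} (hr0 : 0 < r0) {P : ℝ × ℝ → ℝ} (hP : ContinuousOn P (Dom r0 H))
    {r : ℝ} (hr : r ∈ Set.Ico (0 : ℝ) (1 / (2 * r0 ^ 2))) :
    IntegrableOn (fun z => PiFun r0 Ω P r z) (Set.Icc 0 H) := by
  refine (aux_fub (ρ := fun _ => r) (fun _ _ => hr) ?_).1
  unfold auxG
  rw [integrable_indicator_iff (aux_Dset_meas H measurable_const)]
  have hD : Dset H (fun _ => r) = Set.Icc 0 r ×ˢ Set.Icc 0 H := by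
    ext p; simp only [Dset, Set.mem_prod, Set.mem_ofPred_eq]; tauto
  refine ContinuousOn.integrableOn_compact ?_
    ((aux_contW hr0 hP).mono (aux_Dset_sub fun _ _ => hr))
  rw [hD]
  exact isCompact_Icc.prod isCompact_Icc

lemma aux_bdd {r0 H : ℝ} {K : NNReal} {P : ℝ × ℝ → ℝ} (hP : LipschitzOnWith K P (Dom r0 H)) :
    ∃ M, 0 ≤ M ∧ ∀ p ∈ Dom r0 H, |P p| ≤ M := by
  have hb : Bornology.IsBounded (Dom r0 H) :=
    (Metric.isBounded_Ico _ _).prod (Metric.isBounded_Icc _ _)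
  obtain ⟨g, hg, hPg⟩ := hP.extend_real
  have hi : Bornology.IsBounded (P '' Dom r0 H) := by
    rw [hPg.image_eq]
    exact hg.isBounded_image hb
  obtain ⟨M, hM⟩ := hi.exists_norm_le
  exact ⟨max M 0, le_max_right _ _, fun p hp => (hM _ ⟨p, hp, rfl⟩).trans (le_max_left _ _)⟩

lemma aux_alg {a M x : ℝ} (ha : 0 < a) (hM : 0 ≤ M) (hx : 0 ≤ x) :
    - (M * (M / a) ^ 2) ≤ (a * x - M) * x ^ 2 := by
  rcases le_total M (a * x) with h | h
  · have : 0 ≤ (a * x - M) * x ^ 2 := mul_nonneg (by linarith) (by positivity)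
    have : 0 ≤ M * (M / a) ^ 2 := by positivity
    linarith
  · have h1 : x ≤ M / a := by rw [le_div_iff₀ ha]; linarith
    have h2 : x ^ 2 ≤ (M / a) ^ 2 := by gcongr
    have h3 : 0 ≤ a * x * x ^ 2 := by positivity
    nlinarith [mul_le_mul_of_nonneg_left h2 hM]

lemma aux_lower {r0 Ω H : ℝ} (hr0 : 0 < r0) (hΩ : 0 < Ω) {P : ℝ × ℝ → ℝ}
    (hP : ContinuousOn P (Dom r0 H)) {M : ℝ} (hM : 0 ≤ M) (hPM : ∀ p ∈ Dom r0 H, |P p| ≤ M) :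
    ∃ C, 0 ≤ C ∧ ∀ z ∈ Set.Icc 0 H, ∀ ρ ∈ Set.Ico (0 : ℝ) (1 / (2 * r0 ^ 2)),
      -C ≤ PiFun r0 Ω P ρ z := by
  set a := Ω ^ 2 * r0 ^ 2 / 2 with ha
  have hapos : 0 < a := by positivity
  set c := M * (M / a) ^ 2 * r0 ^ 4 with hc
  have hcpos : 0 ≤ c := by positivity
  refine ⟨(1 / (2 * r0 ^ 2)) * c, by positivity, fun z hz ρ hρ => ?_⟩
  have h1 : ∫ s in (0:ℝ)..ρ, (-c) ≤ PiFun r0 Ω P ρ z := by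
    unfold PiFun
    refine intervalIntegral.integral_mono_on hρ.1 (by simp) ?_ ?_
    · apply ContinuousOn.intervalIntegrable
      rw [Set.uIcc_of_le hρ.1]
      exact aux_contz hr0 hP hz hρ.2
    · intro s hs
      have hs' := hs.2.trans_lt hρ.2
      have ht := aux_pos hr0 hs'
      have hp := (abs_le.1 (hPM (s, z) ⟨⟨hs.1, hs'⟩, hz⟩)).2
      have hal := aux_alg hapos hM (inv_pos.2 ht).le
      set t := 1 - 2 * s * r0 ^ 2
      have e1 : Ω ^ 2 * r0 ^ 2 / (2 * t) = a * t⁻¹ := by rw [ha]; field_simp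
      have e2 : eFun r0 s = r0 ^ 4 * t⁻¹ ^ 2 := by
        change r0 ^ 4 / t ^ 2 = _
        field_simp
      rw [e1, e2]
      calc -c = - (M * (M / a) ^ 2) * r0 ^ 4 := by rw [hc]; ring
        _ ≤ (a * t⁻¹ - M) * t⁻¹ ^ 2 * r0 ^ 4 := by gcongr
        _ = (a * t⁻¹ - M) * (r0 ^ 4 * t⁻¹ ^ 2) := by ring
        _ ≤ _ := by gcongr
  simp only [intervalIntegral.integral_const, smul_eq_mul, sub_zero] at h1
  have := mul_le_mul_of_nonneg_right hρ.2.le hcpos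
  linarith

lemma aux_rat {r0 Ω H : ℝ} (hr0 : 0 < r0) {P : ℝ × ℝ → ℝ} (hP : ContinuousOn P (Dom r0 H))
    {z x y : ℝ} (hz : z ∈ Set.Icc 0 H) (hx : x ∈ Set.Ico (0 : ℝ) (1 / (2 * r0 ^ 2)))
    (hxy : PiFun r0 Ω P x z < y) :
    ∃ q : ℚ, (q : ℝ) ∈ Set.Ico (0 : ℝ) (1 / (2 * r0 ^ 2)) ∧ PiFun r0 Ω P q z < y := by
  obtain ⟨b, hb1, hb2⟩ := exists_between hx.2
  have hb0 : 0 ≤ b := hx.1.trans hb1.le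
  have hc : ContinuousOn (fun x => PiFun r0 Ω P x z) (Set.Icc 0 b) := by
    unfold PiFun
    have := intervalIntegral.continuousOn_primitive_interval (a := 0) (b := b) (μ := volume)
      (f := fun s : ℝ => (Ω ^ 2 * r0 ^ 2 / (2 * (1 - 2 * s * r0 ^ 2)) - P (s, z)) * eFun r0 s)
      (by rw [Set.uIcc_of_le hb0]
          exact (aux_contz hr0 hP hz hb2).integrableOn_compact isCompact_Icc)
    rwa [Set.uIcc_of_le hb0] at this
  have h1 : ∀ᶠ t in nhdsWithin x (Set.Ioo x b), PiFun r0 Ω P t z < y := by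
    have := (hc x ⟨hx.1, hb1.le⟩).mono (t := Set.Icc 0 b) (s := Set.Ioo x b)
      (fun t ht => ⟨hx.1.trans ht.1.le, ht.2.le⟩)
    exact this.eventually_lt_const hxy
  rw [nhdsWithin_Ioo_eq_nhdsGT hb1] at h1
  obtain ⟨u, hu, hsub⟩ := mem_nhdsGT_iff_exists_Ioo_subset.1 h1
  obtain ⟨q, hq1, hq2⟩ := exists_rat_btwn (lt_min (Set.mem_Ioi.1 hu) hx.2)
  exact ⟨q, ⟨hx.1.trans hq1.le, hq2.trans_le (min_le_right _ _)⟩,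
    hsub ⟨hq1, hq2.trans_le (min_le_left _ _)⟩⟩

lemma aux_part_b {r0 Ω H : ℝ} (hr0 : 0 < r0) (hΩ : 0 < Ω) (hH : 0 < H) {P : ℝ × ℝ → ℝ}
    (hP : ContinuousOn P (Dom r0 H)) {M : ℝ} (hM : 0 ≤ M) (hPM : ∀ p ∈ Dom r0 H, |P p| ≤ M)
    {ρ : ℝ → ℝ} (hρm : Measurable ρ)
    (hρ : ∀ z ∈ Set.Icc (0 : ℝ) H, ρ z ∈ Set.Ico (0 : ℝ) (1 / (2 * r0 ^ 2)))
    (hint : IntegrableOn (fun z => PiFun r0 Ω P (ρ z) z) (Set.Icc 0 H)) :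
    jP r0 Ω H P ≤ ∫ z in Set.Icc 0 H, PiFun r0 Ω P (ρ z) z ∧
    ((∫ z in Set.Icc 0 H, PiFun r0 Ω P (ρ z) z) = jP r0 Ω H P ↔
      ∀ᵐ z ∂(volume.restrict (Set.Icc (0 : ℝ) H)), ρ z ∈ ArgminPi r0 Ω P z) := by
  have hL : (0:ℝ) < 1 / (2 * r0 ^ 2) := by positivity
  have h0mem : (0:ℝ) ∈ Set.Ico (0 : ℝ) (1 / (2 * r0 ^ 2)) := ⟨le_rfl, hL⟩
  have hI : ∀ f : ℝ → ℝ, ∫ z in (0:ℝ)..H, f z = ∫ z in Set.Icc 0 H, f z := fun f => by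
    rw [integral_Icc_eq_integral_Ioc, intervalIntegral.integral_of_le hH.le]
  have hmemIcc : ∀ᵐ z ∂(volume.restrict (Set.Icc (0 : ℝ) H)), z ∈ Set.Icc 0 H :=
    ae_restrict_mem measurableSet_Icc
  obtain ⟨C, hC, hlow⟩ := aux_lower hr0 hΩ hP hM hPM
  have hbdd : BddBelow {x : ℝ | ∃ ρt : ℝ → ℝ, Measurable ρt ∧
      (∀ z, ρt z ∈ Set.Ico (0 : ℝ) (1 / (2 * r0 ^ 2))) ∧
      x = ∫ z in (0 : ℝ)..H, PiFun r0 Ω P (ρt z) z} := by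
    refine ⟨-(C * H), ?_⟩
    rintro _ ⟨ρt, -, hρt, rfl⟩
    rw [hI]
    by_cases hi : IntegrableOn (fun z => PiFun r0 Ω P (ρt z) z) (Set.Icc 0 H)
    · have := setIntegral_mono_on (f := fun _ => -C) (by simp) hi measurableSet_Icc
        (fun z hz => hlow z hz _ (hρt z))
      simp [hH.le] at this
      linarith
    · rw [integral_undef hi]
      have := mul_nonneg hC hH.le
      linarith
  have hle : ∀ ρt : ℝ → ℝ, Measurable ρt →
      (∀ z ∈ Set.Icc 0 H, ρt z ∈ Set.Ico (0 : ℝ) (1 / (2 * r0 ^ 2))) →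
      jP r0 Ω H P ≤ ∫ z in Set.Icc 0 H, PiFun r0 Ω P (ρt z) z := by
    intro ρt hm hr
    refine csInf_le hbdd ⟨(Set.Icc 0 H).indicator ρt, hm.indicator measurableSet_Icc, ?_, ?_⟩
    · intro z
      by_cases hz : z ∈ Set.Icc 0 H
      · rw [Set.indicator_of_mem hz]; exact hr z hz
      · rw [Set.indicator_of_notMem hz]; exact h0mem
    · rw [hI]
      refine setIntegral_congr_fun measurableSet_Icc fun z hz => ?_
      simp only [Set.indicator_of_mem hz]
  refine ⟨hle ρ hρm hρ, ?_, ?_⟩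
  · intro heq
    have key : ∀ q : ℚ, (q : ℝ) ∈ Set.Ico (0 : ℝ) (1 / (2 * r0 ^ 2)) →
        ∀ᵐ z ∂(volume.restrict (Set.Icc (0 : ℝ) H)),
          PiFun r0 Ω P (ρ z) z ≤ PiFun r0 Ω P q z := by
      intro q hq
      set f : ℝ → ℝ := fun z => PiFun r0 Ω P (ρ z) z - PiFun r0 Ω P q z with hf
      have hfi : IntegrableOn f (Set.Icc 0 H) := hint.sub (aux_const hr0 hP hq)
      obtain ⟨g, hgm, hfg⟩ := hfi.aestronglyMeasurable
      have hA : MeasurableSet {z | 0 < g z} := measurableSet_lt measurable_const hgm.measurable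
      classical
      have hl := hle (fun z => if 0 < g z then (q : ℝ) else ρ z)
        (Measurable.ite hA measurable_const hρm) (fun z hz => by
          split_ifs
          · exact hq
          · exact hρ z hz)
      have hcg : ∫ z in Set.Icc 0 H, PiFun r0 Ω P (if 0 < g z then (q : ℝ) else ρ z) z
          = ∫ z in Set.Icc 0 H, (PiFun r0 Ω P (ρ z) z - max (f z) 0) := by
        refine integral_congr_ae ?_
        filter_upwards [hfg] with z hz
        rw [← hz]
        split_ifs with h
        · rw [max_eq_left h.le, hf]; ring
        · rw [max_eq_right (not_lt.1 h), sub_zero]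
      rw [hcg, integral_sub hint hfi.pos_part, heq] at hl
      have hz0 : ∫ z in Set.Icc 0 H, max (f z) 0 = 0 :=
        le_antisymm (by linarith) (integral_nonneg fun z => le_max_right _ _)
      replace hz0 := (integral_eq_zero_iff_of_nonneg (f := fun z => max (f z) 0)
        (fun z => le_max_right _ _) hfi.pos_part).1 hz0
      filter_upwards [hz0] with z hz
      have : f z ≤ 0 := by
        have := le_max_left (f z) 0
        simp only [Pi.zero_apply] at hz
        linarith
      simp only [hf] at this
      linarith
    have key2 : ∀ᵐ z ∂(volume.restrict (Set.Icc (0 : ℝ) H)), ∀ q : ℚ,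
        (q : ℝ) ∈ Set.Ico (0 : ℝ) (1 / (2 * r0 ^ 2)) →
          PiFun r0 Ω P (ρ z) z ≤ PiFun r0 Ω P q z := by
      rw [ae_all_iff]
      intro q
      by_cases hq : (q : ℝ) ∈ Set.Ico (0 : ℝ) (1 / (2 * r0 ^ 2))
      · filter_upwards [key q hq] with z hz _
        exact hz
      · exact Filter.Eventually.of_forall fun z h => absurd h hq
    filter_upwards [key2, hmemIcc] with z h1 hz
    refine ⟨hρ z hz, fun x hx => ?_⟩
    by_contra! hlt
    obtain ⟨q, hq, hq2⟩ := aux_rat hr0 hP hz hx hlt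
    exact absurd (h1 q hq) (not_le.2 hq2)
  · intro hae
    apply le_antisymm _ (hle ρ hρm hρ)
    refine le_csInf ⟨_, fun _ => 0, measurable_const, fun _ => h0mem, rfl⟩ ?_
    rintro _ ⟨ρt, -, hρt, rfl⟩
    rw [hI]
    by_cases hi : IntegrableOn (fun z => PiFun r0 Ω P (ρt z) z) (Set.Icc 0 H)
    · refine integral_mono_ae hint hi ?_
      filter_upwards [hae] with z hz
      exact hz.2 _ (hρt z)
    · rw [integral_undef hi]
      refine integral_nonpos_of_ae ?_
      filter_upwards [hae] with z hz
      have := hz.2 0 h0mem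
      simpa [PiFun] using this

/-- characterization of equality in the duality: equality `I(ρ,γ) = J[σ](Ψ,P)`
holds iff `γ = (id × ∇P)_# (e χ_{D_ρ} ℒ²)` and `ρ(z) ∈ Argmin Π_P(·,z)` for a.e. `z ∈ [0,H]`. -/
theorem stmt16 (r0 Ω H R0 : ℝ) (hr0 : 0 < r0) (hΩ : 0 < Ω) (hH : 0 < H) (hR0 : 1 < R0)
    (Δ : Set (ℝ × ℝ)) (hΔcl : IsClosed Δ) (hΔ : Δ ⊆ Set.Icc (0, 0) (R0, R0))
    (σ : Measure (ℝ × ℝ)) [IsProbabilityMeasure σ] (hσΔ : σ Δᶜ = 0)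
    (P Ψ : ℝ × ℝ → ℝ) (hU0 : memU0 r0 H Δ P Ψ)
    (ρ : ℝ → ℝ) (hρmeas : Measurable ρ)
    (hρ : ∀ z ∈ Set.Icc (0 : ℝ) H, ρ z ∈ Set.Ico (0 : ℝ) (1 / (2 * r0 ^ 2)))
    (hmass : muD r0 H ρ Set.univ = 1)
    (γ : Measure ((ℝ × ℝ) × (ℝ × ℝ)))
    (hγ1 : γ.map Prod.fst = muD r0 H ρ) (hγ2 : γ.map Prod.snd = σ)
    (hcost : Integrable (cost r0 Ω) γ)
    (hΨint : Integrable (fun q : ℝ × ℝ => q.1 / (2 * r0 ^ 2) - Ω * Real.sqrt q.1 - Ψ q) σ) :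
    (∫ pq, cost r0 Ω pq ∂γ) = Jfun r0 Ω H σ Ψ P ↔
      (γ = (muD r0 H ρ).map (fun p : ℝ × ℝ => (p, gradP P p)) ∧
        ∀ᵐ z ∂(volume.restrict (Set.Icc (0 : ℝ) H)), ρ z ∈ ArgminPi r0 Ω P z) := by
  have hne : Δ.Nonempty := by
    by_contra h
    rw [Set.not_nonempty_iff_eq_empty] at h
    rw [h, Set.compl_empty, measure_univ] at hσΔ
    exact one_ne_zero hσΔ
  have hLip := aux_P_lip hR0 hΔ hne hU0
  have hPc := hLip.continuousOn
  obtain ⟨M, hM, hPM⟩ := aux_bdd hLip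
  have : IsProbabilityMeasure (muD r0 H ρ) := ⟨hmass⟩
  have : IsProbabilityMeasure γ := ⟨by
    rw [← hmass, ← hγ1, Measure.map_apply measurable_fst MeasurableSet.univ, Set.preimage_univ]⟩
  have hpD : ∀ᵐ p ∂(muD r0 H ρ), p ∈ Dom r0 H := by
    filter_upwards [aux_ae_Dset hρmeas] with p hp
    exact aux_Dset_sub hρ hp
  have hpγ : ∀ᵐ pq ∂γ, pq.1 ∈ Dom r0 H := by
    rw [← hγ1] at hpD
    exact ae_of_ae_map measurable_fst.aemeasurable hpD
  have hqσ : ∀ᵐ q ∂σ, q ∈ Δ := hσΔ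
  have hqγ : ∀ᵐ pq ∂γ, pq.2 ∈ Δ := by
    have h := hqσ
    rw [← hγ2] at h
    exact ae_of_ae_map measurable_snd.aemeasurable h
  -- integrability
  have hPi : Integrable P (muD r0 H ρ) := by
    refine Integrable.of_bound (C := M) ?_ ?_
    · have h1 : (muD r0 H ρ).restrict (Dom r0 H) = muD r0 H ρ :=
        Measure.restrict_eq_self_of_ae_mem hpD
      rw [← h1]
      exact hPc.aestronglyMeasurable (aux_Dom_meas r0 H)
    · filter_upwards [hpD] with p hp
      exact hPM p hp
  have hPγ : Integrable (fun pq : (ℝ × ℝ) × (ℝ × ℝ) => P pq.1) γ := by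
    rw [← hγ1] at hPi
    exact hPi.comp_measurable measurable_fst
  have hkσ : Integrable (fun q : ℝ × ℝ => q.1 / (2 * r0 ^ 2) - Ω * Real.sqrt q.1) σ := by
    refine Integrable.of_bound (C := R0 / (2 * r0 ^ 2) + Ω * Real.sqrt R0) ?_ ?_
    · exact Continuous.aestronglyMeasurable (by fun_prop)
    · filter_upwards [hqσ] with q hq
      obtain ⟨a, b, _, _⟩ := aux_delta_bd hΔ hq
      have h1 : 0 ≤ q.1 / (2 * r0 ^ 2) := by positivity
      have h2 : q.1 / (2 * r0 ^ 2) ≤ R0 / (2 * r0 ^ 2) := by gcongr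
      have h3 : 0 ≤ Ω * Real.sqrt q.1 := by positivity
      have h4 : Ω * Real.sqrt q.1 ≤ Ω * Real.sqrt R0 := by gcongr
      rw [Real.norm_eq_abs, abs_le]
      constructor <;> linarith
  have hΨσ : Integrable Ψ σ := by
    refine (hkσ.sub hΨint).congr (Filter.Eventually.of_forall fun q => ?_)
    simp
  have hΨγ : Integrable (fun pq : (ℝ × ℝ) × (ℝ × ℝ) => Ψ pq.2) γ := by
    rw [← hγ2] at hΨσ
    exact hΨσ.comp_measurable measurable_snd
  have hKγ : Integrable (fun pq : (ℝ × ℝ) × (ℝ × ℝ) =>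
      pq.2.1 / (2 * r0 ^ 2) - Ω * Real.sqrt pq.2.1 - Ψ pq.2) γ := by
    rw [← hγ2] at hΨint
    exact hΨint.comp_measurable measurable_snd
  have hpqγ : Integrable (fun pq : (ℝ × ℝ) × (ℝ × ℝ) =>
      pq.1.1 * pq.2.1 + pq.1.2 * pq.2.2) γ := by
    refine Integrable.of_bound (C := 1 / (2 * r0 ^ 2) * R0 + H * R0) ?_ ?_
    · exact Continuous.aestronglyMeasurable (by fun_prop)
    · filter_upwards [hpγ, hqγ] with pq hp hq
      obtain ⟨a, b, c, d⟩ := aux_delta_bd hΔ hq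
      obtain ⟨a', b', c', d'⟩ := aux_dom_bd hp
      rw [Real.norm_eq_abs, abs_of_nonneg (by positivity)]
      gcongr
  have hFi : Integrable (fun pq : (ℝ × ℝ) × (ℝ × ℝ) =>
      P pq.1 + Ψ pq.2 - (pq.1.1 * pq.2.1 + pq.1.2 * pq.2.2)) γ := (hPγ.add hΨγ).sub hpqγ
  have hdec : ∀ pq : (ℝ × ℝ) × (ℝ × ℝ), cost r0 Ω pq =
      (P pq.1 + Ψ pq.2 - (pq.1.1 * pq.2.1 + pq.1.2 * pq.2.2)) +
      (pq.2.1 / (2 * r0 ^ 2) - Ω * Real.sqrt pq.2.1 - Ψ pq.2) + auxW r0 Ω P pq.1 := by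
    intro pq
    unfold cost auxW
    rw [show 2 * r0 ^ 2 * pq.1.1 = 2 * pq.1.1 * r0 ^ 2 by ring, mul_comm (r0 ^ 2) (Ω ^ 2)]
    ring
  have hWγ : Integrable (fun pq : (ℝ × ℝ) × (ℝ × ℝ) => auxW r0 Ω P pq.1) γ := by
    refine ((hcost.sub hFi).sub hKγ).congr (Filter.Eventually.of_forall fun pq => ?_)
    simp only [Pi.sub_apply, hdec pq]
    ring
  have hWm : AEStronglyMeasurable (auxW r0 Ω P) (muD r0 H ρ) := by
    unfold auxW
    refine AEStronglyMeasurable.sub ?_ hPi.aestronglyMeasurable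
    exact Measurable.aestronglyMeasurable (by fun_prop)
  have hWi : Integrable (auxW r0 Ω P) (muD r0 H ρ) := by
    rw [← hγ1] at hWm ⊢
    exact (integrable_map_measure hWm measurable_fst.aemeasurable).2 hWγ
  have hWeq : ∫ pq, auxW r0 Ω P pq.1 ∂γ = ∫ p, auxW r0 Ω P p ∂(muD r0 H ρ) := by
    rw [← hγ1] at hWm ⊢
    exact (integral_map measurable_fst.aemeasurable hWm).symm
  have hKeq : ∫ pq : (ℝ × ℝ) × (ℝ × ℝ),
      (pq.2.1 / (2 * r0 ^ 2) - Ω * Real.sqrt pq.2.1 - Ψ pq.2) ∂γ =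
      ∫ q : ℝ × ℝ, (q.1 / (2 * r0 ^ 2) - Ω * Real.sqrt q.1 - Ψ q) ∂σ := by
    have hm := hΨint.aestronglyMeasurable
    rw [← hγ2] at hm ⊢
    exact (integral_map measurable_snd.aemeasurable hm).symm
  -- the density
  have hdm : Measurable (fun p : ℝ × ℝ =>
      ENNReal.ofReal ((Dset H ρ).indicator (fun p : ℝ × ℝ => eFun r0 p.1) p)) :=
    (((aux_eFun_meas r0).comp measurable_fst).indicator (aux_Dset_meas H hρmeas)).ennreal_ofReal
  have hsm : ∀ p : ℝ × ℝ, (ENNReal.ofReal ((Dset H ρ).indicator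
      (fun p : ℝ × ℝ => eFun r0 p.1) p)).toReal • auxW r0 Ω P p = auxG r0 Ω H P ρ p := by
    intro p
    unfold auxG
    by_cases hp : p ∈ Dset H ρ
    · rw [Set.indicator_of_mem hp, Set.indicator_of_mem hp, ENNReal.toReal_ofReal, smul_eq_mul,
        mul_comm]
      unfold eFun
      positivity
    · rw [Set.indicator_of_notMem hp, Set.indicator_of_notMem hp]
      simp
  have hGi : Integrable (auxG r0 Ω H P ρ) volume := by
    have h := (integrable_withDensity_iff_integrable_smul' hdm
      (Filter.Eventually.of_forall fun p => ENNReal.ofReal_lt_top)).1 hWi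
    simpa only [hsm] using h
  have hGeq : ∫ p, auxW r0 Ω P p ∂(muD r0 H ρ) = ∫ p, auxG r0 Ω H P ρ p := by
    unfold muD
    rw [integral_withDensity_eq_integral_toReal_smul hdm
      (Filter.Eventually.of_forall fun p => ENNReal.ofReal_lt_top)]
    simp only [hsm]
  obtain ⟨hPiInt, hPiEq⟩ := aux_fub hρ hGi
  obtain ⟨hjle, hjiff⟩ := aux_part_b hr0 hΩ hH hPc hM hPM hρmeas hρ hPiInt
  have hFnn : 0 ≤ᵐ[γ] (fun pq : (ℝ × ℝ) × (ℝ × ℝ) =>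
      P pq.1 + Ψ pq.2 - (pq.1.1 * pq.2.1 + pq.1.2 * pq.2.2)) := by
    filter_upwards [hpγ, hqγ] with pq hp hq
    obtain ⟨a, _, b, _⟩ := aux_delta_bd hΔ hq
    have := hU0.2.2 pq.1 hp pq.2 a b
    simp only [Pi.zero_apply]
    linarith
  have hFint := integral_nonneg_of_ae hFnn
  have htot : ∫ pq, cost r0 Ω pq ∂γ =
      (∫ pq : (ℝ × ℝ) × (ℝ × ℝ), (P pq.1 + Ψ pq.2 - (pq.1.1 * pq.2.1 + pq.1.2 * pq.2.2)) ∂γ) +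
      (∫ q : ℝ × ℝ, (q.1 / (2 * r0 ^ 2) - Ω * Real.sqrt q.1 - Ψ q) ∂σ) +
      ∫ z in Set.Icc 0 H, PiFun r0 Ω P (ρ z) z := by
    rw [← hPiEq, ← hGeq, ← hWeq, ← hKeq, ← integral_add hFi hKγ]
    exact (integral_congr_ae (Filter.Eventually.of_forall hdec)).trans
      (integral_add (hFi.add hKγ) hWγ)
  rw [← aux_part_a hr0 hH hR0 hΔcl hΔ hne hσΔ hU0 hρmeas hρ hγ1 hγ2, ← hjiff, htot]
  have hz := integral_eq_zero_iff_of_nonneg_ae hFnn hFi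
  unfold Jfun
  constructor
  · intro h
    refine ⟨hz.1 (by linarith), by linarith⟩
  · rintro ⟨h1, h2⟩
    rw [hz.2 h1, h2]
    ring
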